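/- Let G = (V, E, w) be a connected finite simple undirected graph on n vertices with nonnegative edge weights, let L_star be the Laplacian of the augmented graph G_star for a parameter α > 0, let S ⊆ V be nonempty, and set A = (αL + I)_{−S}. Then: (i) L_star_{−S} is invertible and n − 1^T A^{-1} 1 > 0; (ii) the (u*, u*) entry of (L_star_{−S})^{-1} equals 1/(n − 1^T A^{-1} 1); (iii) the (V∖S)×(V∖S) block of (L_star_{−S})^{-1} equals (A − (1/n)·J)^{-1}, where J is the all-ones matrix of the appropriate size; consequently trace((L_star_{−S})^{-1}) = 1/(n − 1^T A^{-1} 1) + trace((A − (1/n)·J)^{-1}). -/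

import Mathlib

open Matrix

variable {V : Type*} [Fintype V] [DecidableEq V]

/-- The weighted Laplacian matrix `L = D - W` of a weighted graph given by its
(symmetric, nonnegative, zero-diagonal) weight matrix `W`. -/
def lap (W : Matrix V V ℝ) : Matrix V V ℝ :=
  Matrix.diagonal (fun v => ∑ u, W v u) - W

/-- The Laplacian of the augmented graph `G_star`: the `V × V` block equals `αL + I`,
the new universal vertex `none` has diagonal entry `n` and off-diagonal entries `-1`. -/
noncomputable def lapStar (α : ℝ) (W : Matrix V V ℝ) : Matrix (Option V) (Option V) ℝ :=
  Matrix.of fun i j =>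
    match i, j with
    | none, none => (Fintype.card V : ℝ)
    | none, some _ => -1
    | some _, none => -1
    | some u, some v => (α • lap W + 1) u v

/-- The grounded matrix `M_{-S}` of a matrix indexed by `Option V`, obtained by
deleting all rows and columns with indices in `S ⊆ V` (the universal vertex `none`
is never deleted). -/
def subOpt (S : Finset V) (M : Matrix (Option V) (Option V) ℝ) :
    Matrix {x : Option V // x ∉ S.image some} {x : Option V // x ∉ S.image some} ℝ :=
  M.submatrix Subtype.val Subtype.val

/-- The submatrix `M_{-S}` of a matrix indexed by `V`, obtained by deleting all rows
and columns with indices in `S`. -/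
def subV (S : Finset V) (M : Matrix V V ℝ) :
    Matrix {v : V // v ∉ S} {v : V // v ∉ S} ℝ :=
  M.submatrix Subtype.val Subtype.val

theorem dotProduct_lap_mulVec (W : Matrix V V ℝ) (hsym : ∀ u v, W u v = W v u) (x : V → ℝ) :
    x ⬝ᵥ (lap W *ᵥ x) = (∑ u, ∑ v, W u v * (x u - x v) ^ 2) / 2 := by
  have hswap : ∑ u, ∑ v, W u v * x v ^ 2 = ∑ u, ∑ v, W u v * x u ^ 2 := by
    rw [Finset.sum_comm]
    simp only [hsym]
  have hlap : x ⬝ᵥ (lap W *ᵥ x)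
      = ∑ u, ∑ v, W u v * x u ^ 2 - ∑ u, ∑ v, W u v * (x u * x v) := by
    rw [lap, sub_mulVec, dotProduct_sub]
    simp only [dotProduct, mulVec_diagonal, Finset.mul_sum, Finset.sum_mul]
    simp only [mulVec, dotProduct, Finset.mul_sum]
    congr 1 <;> exact Finset.sum_congr rfl fun u _ => Finset.sum_congr rfl fun v _ => by ring
  have hsq : ∑ u, ∑ v, W u v * (x u - x v) ^ 2
      = ∑ u, ∑ v, W u v * x u ^ 2 + ∑ u, ∑ v, W u v * x v ^ 2
        - 2 * ∑ u, ∑ v, W u v * (x u * x v) := by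
    simp only [Finset.mul_sum, ← Finset.sum_add_distrib, ← Finset.sum_sub_distrib]
    exact Finset.sum_congr rfl fun u _ => Finset.sum_congr rfl fun v _ => by ring
  rw [hsq, hswap, hlap]
  ring

theorem lap_posSemidef (W : Matrix V V ℝ) (hsym : ∀ u v, W u v = W v u)
    (hnn : ∀ u v, 0 ≤ W u v) : (lap W).PosSemidef := by
  refine .of_dotProduct_mulVec_nonneg ?_ fun x => ?_
  · have hW : W.IsHermitian := by
      ext u v
      simp [hsym v u]
    exact (isHermitian_diagonal _).sub hW
  · rw [star_trivial, dotProduct_lap_mulVec W hsym]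
    exact div_nonneg (Finset.sum_nonneg fun u _ => Finset.sum_nonneg fun v _ =>
      mul_nonneg (hnn u v) (sq_nonneg _)) zero_le_two

section

variable {m : Type*} [Fintype m]

theorem dotProduct_sub_smul_ones_mulVec (A : Matrix m m ℝ) (r : ℝ) (x : m → ℝ) :
    x ⬝ᵥ ((A - r • Matrix.of fun _ _ => (1 : ℝ)) *ᵥ x) = x ⬝ᵥ (A *ᵥ x) - r * (∑ i, x i) ^ 2 := by
  simp only [sub_mulVec, dotProduct_sub, smul_mulVec, dotProduct_smul, smul_eq_mul]
  congr 2
  simp [dotProduct, mulVec, ← Finset.sum_mul, sq]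

/-- Subtracting `J / c` from a matrix `≥ 1` of size less than `c` keeps it positive definite. -/
theorem Matrix.PosSemidef.posDef_add_one_sub_smul_ones [DecidableEq m] {P : Matrix m m ℝ}
    (hP : P.PosSemidef) {c : ℝ} (hc : (Fintype.card m : ℝ) < c) :
    (P + 1 - ((1 : ℝ) / c) • (Matrix.of fun _ _ => (1 : ℝ))).PosDef := by
  have hc0 : 0 < c := (Nat.cast_nonneg _).trans_lt hc
  refine .of_dotProduct_mulVec_pos ?_ fun x hx => ?_
  · refine (hP.1.add isHermitian_one).sub ?_
    ext i j
    simp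
  · have hPx := hP.dotProduct_mulVec_nonneg x
    rw [star_trivial] at hPx ⊢
    have hxx : 0 < ∑ i, x i ^ 2 := by
      obtain ⟨i, hi⟩ := Function.ne_iff.mp hx
      exact Finset.sum_pos' (fun _ _ => sq_nonneg _) ⟨i, Finset.mem_univ i, sq_pos_of_ne_zero hi⟩
    have hcs : (∑ i, x i) ^ 2 ≤ Fintype.card m * ∑ i, x i ^ 2 :=
      sq_sum_le_card_mul_sum_sq
    have hlt : 1 / c * (∑ i, x i) ^ 2 < ∑ i, x i ^ 2 := by
      rw [one_div_mul_eq_div, div_lt_iff₀ hc0]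
      nlinarith
    have hone : x ⬝ᵥ x = ∑ i, x i ^ 2 := by simp [dotProduct, sq]
    rw [dotProduct_sub_smul_ones_mulVec, add_mulVec, one_mulVec, dotProduct_add, hone]
    linarith

theorem sub_ones_dotProduct_inv_mulVec_pos [DecidableEq m] {A : Matrix m m ℝ} (hA : A.PosDef)
    {c : ℝ} (hc : 0 < c)
    (hAc : (A - ((1 : ℝ) / c) • (Matrix.of fun _ _ => (1 : ℝ))).PosDef) :
    0 < c - (fun _ => (1 : ℝ)) ⬝ᵥ (A⁻¹ *ᵥ (fun _ => (1 : ℝ))) := by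
  set x : m → ℝ := A⁻¹ *ᵥ (fun _ => (1 : ℝ)) with hx
  have hAx : A *ᵥ x = fun _ => 1 := by
    rw [hx, mulVec_mulVec, mul_nonsing_inv _ ((isUnit_iff_isUnit_det _).mp hA.isUnit), one_mulVec]
  have hs : (fun _ => (1 : ℝ)) ⬝ᵥ x = ∑ i, x i := by simp [dotProduct]
  by_cases hx0 : x = 0
  · simpa [hx0] using hc
  · have hpos := hA.dotProduct_mulVec_pos hx0
    have hpos' := hAc.dotProduct_mulVec_pos hx0
    rw [star_trivial, hAx, dotProduct_comm, hs] at hpos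
    rw [star_trivial, dotProduct_sub_smul_ones_mulVec, hAx, dotProduct_comm, hs, sub_pos,
      one_div_mul_eq_div, div_lt_iff₀ hc] at hpos'
    rw [hs]
    nlinarith

/-- Inverse of `A` bordered by a row and a column of `-1`s, with corner entry `c`. -/
theorem inv_fromBlocks_neg_ones [DecidableEq m] {A : Matrix m m ℝ} {c : ℝ} (hA : IsUnit A)
    (hc : c ≠ 0)
    (hs : c - (fun _ => (1 : ℝ)) ⬝ᵥ (A⁻¹ *ᵥ (fun _ => (1 : ℝ))) ≠ 0)
    (hAc : IsUnit (A - ((1 : ℝ) / c) • (Matrix.of fun _ _ => (1 : ℝ))))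
    {N : Matrix (m ⊕ Unit) (m ⊕ Unit) ℝ}
    (hN : N = fromBlocks A (of fun _ _ => -1) (of fun _ _ => -1) (of fun _ _ => c)) :
    IsUnit N.det ∧
    N⁻¹ (Sum.inr ()) (Sum.inr ()) = 1 / (c - (fun _ => (1 : ℝ)) ⬝ᵥ (A⁻¹ *ᵥ (fun _ => (1 : ℝ)))) ∧
    ∀ i j, N⁻¹ (Sum.inl i) (Sum.inl j)
        = ((A - ((1 : ℝ) / c) • (Matrix.of fun _ _ => (1 : ℝ)))⁻¹ : Matrix m m ℝ) i j := by
  subst hN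
  set B : Matrix m Unit ℝ := of fun _ _ => -1 with hB
  set C : Matrix Unit m ℝ := of fun _ _ => -1 with hC
  set D : Matrix Unit Unit ℝ := of fun _ _ => c with hD
  have hDdet : IsUnit D := by
    rw [isUnit_iff_isUnit_det]
    simpa [hD] using hc
  have hDinv : D⁻¹ = of fun _ _ => c⁻¹ := by
    refine inv_eq_right_inv ?_
    ext
    simp [hD, mul_apply, hc]
  have hschurD : A - B * D⁻¹ * C = A - ((1 : ℝ) / c) • (of fun _ _ => (1 : ℝ)) := by
    rw [hDinv]
    ext i j
    simp [hB, hC, mul_apply]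
  have hschurA : D - C * A⁻¹ * B
      = of fun _ _ => c - (fun _ => (1 : ℝ)) ⬝ᵥ (A⁻¹ *ᵥ (fun _ => (1 : ℝ))) := by
    ext
    simp [hB, hC, hD, mul_apply, mulVec, dotProduct]
    exact Finset.sum_comm
  have hschurA_inv : (D - C * A⁻¹ * B)⁻¹
      = of fun _ _ => (c - (fun _ => (1 : ℝ)) ⬝ᵥ (A⁻¹ *ᵥ (fun _ => (1 : ℝ))))⁻¹ := by
    refine inv_eq_right_inv ?_
    rw [hschurA]
    ext
    simp only [mul_apply, of_apply, Finset.univ_unique, Finset.sum_singleton,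
      mul_inv_cancel₀ hs, one_apply_eq]
  let := hA.invertible
  let := hDdet.invertible
  let : Invertible (A - B * ⅟D * C) := by
    rw [← hschurD, ← invOf_eq_nonsing_inv] at hAc
    exact hAc.invertible
  let := fromBlocks₂₂Invertible A B C D
  let := invertibleOfFromBlocks₁₁Invertible A B C D
  refine ⟨isUnit_det_of_invertible _, ?_, fun i j => ?_⟩
  · rw [← invOf_eq_nonsing_inv, invOf_fromBlocks₁₁_eq, fromBlocks_apply₂₂]
    simp only [invOf_eq_nonsing_inv, hschurA_inv, of_apply, one_div]
  · rw [← invOf_eq_nonsing_inv, invOf_fromBlocks₂₂_eq, fromBlocks_apply₁₁]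
    simp only [invOf_eq_nonsing_inv, hschurD]

end

/-- The indices surviving the deletion of `S`: the vertices outside `S`, and `none`. -/
def sumUnitEquivNotMemImageSome (S : Finset V) :
    {v : V // v ∉ S} ⊕ Unit ≃ {x : Option V // x ∉ S.image some} where
  toFun
    | Sum.inl v => ⟨some v.1, by simpa using v.2⟩
    | Sum.inr _ => ⟨none, by simp⟩
  invFun
    | ⟨some v, h⟩ => Sum.inl ⟨v, by simpa using h⟩
    | ⟨none, _⟩ => Sum.inr ()
  left_inv := by rintro (_ | _) <;> rfl
  right_inv := by rintro ⟨_ | _, _⟩ <;> rfl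

theorem subOpt_lapStar_submatrix (α : ℝ) (W : Matrix V V ℝ) (S : Finset V) :
    (subOpt S (lapStar α W)).submatrix (sumUnitEquivNotMemImageSome S)
      (sumUnitEquivNotMemImageSome S)
    = fromBlocks (subV S (α • lap W + 1)) (of fun _ _ => -1) (of fun _ _ => -1)
        (of fun _ _ => (Fintype.card V : ℝ)) := by
  ext (_ | _) (_ | _) <;> rfl

/-- with `A = (αL + I)_{-S}` for nonempty `S ⊆ V` and `G` connected:
(i) `L_star_{-S}` is invertible and `n - 1ᵀA⁻¹1 > 0`;
(ii) the `(u*, u*)` entry of `(L_star_{-S})⁻¹` equals `1/(n - 1ᵀA⁻¹1)`;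
(iii) the `(V∖S)×(V∖S)` block of `(L_star_{-S})⁻¹` equals `(A - (1/n)·J)⁻¹`;
consequently `trace((L_star_{-S})⁻¹) = 1/(n - 1ᵀA⁻¹1) + trace((A - (1/n)·J)⁻¹)`. -/
theorem grounded_lapStar_inverse_blocks
    (W : Matrix V V ℝ) (hsym : ∀ u v, W u v = W v u) (hnn : ∀ u v, 0 ≤ W u v)
    (hdiag : ∀ v, W v v = 0)
    (hconn : (SimpleGraph.fromRel fun a b => W a b ≠ 0).Connected)
    (α : ℝ) (hα : 0 < α) (S : Finset V) (hS : S.Nonempty) :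
    IsUnit (subOpt S (lapStar α W)).det ∧
    0 < (Fintype.card V : ℝ) - (fun _ => (1 : ℝ)) ⬝ᵥ
        ((subV S (α • lap W + 1))⁻¹ *ᵥ (fun _ => (1 : ℝ) : {v : V // v ∉ S} → ℝ)) ∧
    (subOpt S (lapStar α W))⁻¹ ⟨none, by simp⟩ ⟨none, by simp⟩
      = 1 / ((Fintype.card V : ℝ) - (fun _ => (1 : ℝ)) ⬝ᵥ
          ((subV S (α • lap W + 1))⁻¹ *ᵥ (fun _ => (1 : ℝ) : {v : V // v ∉ S} → ℝ))) ∧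
    (∀ u u' : {v : V // v ∉ S},
      (subOpt S (lapStar α W))⁻¹ ⟨some u.1, by simpa using u.2⟩ ⟨some u'.1, by simpa using u'.2⟩
        = ((subV S (α • lap W + 1) - ((1 : ℝ) / (Fintype.card V : ℝ)) •
            (Matrix.of fun _ _ => (1 : ℝ)))⁻¹ :
              Matrix {v : V // v ∉ S} {v : V // v ∉ S} ℝ) u u') ∧
    Matrix.trace ((subOpt S (lapStar α W))⁻¹)
      = 1 / ((Fintype.card V : ℝ) - (fun _ => (1 : ℝ)) ⬝ᵥ
            ((subV S (α • lap W + 1))⁻¹ *ᵥ (fun _ => (1 : ℝ) : {v : V // v ∉ S} → ℝ)))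
        + Matrix.trace ((subV S (α • lap W + 1) - ((1 : ℝ) / (Fintype.card V : ℝ)) •
            (Matrix.of fun _ _ => (1 : ℝ)))⁻¹) := by
  have hsub : subV S (α • lap W + 1) = subV S (α • lap W) + 1 := by
    simp [subV, submatrix_add, submatrix_one _ Subtype.val_injective]
  have hP : (subV S (α • lap W)).PosSemidef :=
    ((lap_posSemidef W hsym hnn).smul hα.le).submatrix _
  have hcard : (Fintype.card {v : V // v ∉ S} : ℝ) < Fintype.card V := by
    obtain ⟨s, hs⟩ := hS
    exact_mod_cast Fintype.card_subtype_lt (x := s) (by simpa using hs)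
  have hc : (0 : ℝ) < Fintype.card V := (Nat.cast_nonneg _).trans_lt hcard
  have hA : (subV S (α • lap W + 1)).PosDef := hsub ▸ PosDef.posSemidef_add hP PosDef.one
  have hAc := hP.posDef_add_one_sub_smul_ones hcard
  rw [← hsub] at hAc
  have hpos := sub_ones_dotProduct_inv_mulVec_pos hA hc hAc
  obtain ⟨hdet, hcorner, hblock⟩ :=
    inv_fromBlocks_neg_ones hA.isUnit hc.ne' hpos.ne' hAc.isUnit
      (subOpt_lapStar_submatrix α W S)
  rw [det_submatrix_equiv_self] at hdet
  simp only [inv_submatrix_equiv, submatrix_apply] at hcorner hblock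
  refine ⟨hdet, hpos, hcorner, hblock, ?_⟩
  rw [trace, ← (sumUnitEquivNotMemImageSome S).sum_comp, Fintype.sum_sum_type, add_comm]
  simp only [diag_apply, hblock, trace, Finset.univ_unique, Finset.sum_singleton]
  exact congrArg (· + _) hcorner
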